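/- arXiv:2509.08861 — 6 statements merged into one kernel-verified Lean document; each statement's English description precedes it below -/
import Mathlib

section
/- Let A be a commutative ring, δ : A → A a derivation, and Q₀, B ∈ A elements satisfying δ(Q₀) = B·Q₀ and δ(B) = 0. Write M for the multiplication-by-Q₀ operator on A. Then for every integer m ≥ 1, the m-th iterate of the composite M ∘ δ satisfies (M ∘ δ)^m = M^m ∘ (δ + (m−1)·B) ∘ (δ + (m−2)·B) ∘ ⋯ ∘ (δ + B) ∘ δ as additive maps on A (the factors δ + k·B, 0 ≤ k ≤ m−1, pairwise commute since δ(B) = 0). -/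
/-- The composite `(δ + (m−1)·B) ∘ ⋯ ∘ (δ + B) ∘ δ`:
`factorComp δ B 0 = id` and
`factorComp δ B (k+1) = (fun f => δ f + k • B * f) ∘ factorComp δ B k`. -/
def factorComp {A : Type*} [CommRing A] (δ : A → A) (B : A) : ℕ → A → A
  | 0 => id
  | (k + 1) => (fun f => δ f + k • B * f) ∘ factorComp δ B k

/-- Powers of an eigenvector of a derivation are eigenvectors. -/
theorem Derivation.apply_pow_of_apply_eq_mul {R A : Type*} [CommRing R] [CommRing A] [Algebra R A]
    (δ : Derivation R A A) {q b : A} (h : δ q = b * q) (k : ℕ) :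
    δ (q ^ k) = k * b * q ^ k := by
  induction k with
  | zero => simp
  | succ k ih =>
    rw [pow_succ, Derivation.leibniz, ih, h]
    simp only [smul_eq_mul]
    push_cast
    ring

/-- If `δ` is a derivation with `δ Q₀ = B * Q₀` and `δ B = 0`, and `M` denotes
multiplication by `Q₀`, then `(M ∘ δ)^m = M^m ∘ (δ + (m−1)·B) ∘ ⋯ ∘ (δ + B) ∘ δ`
as maps on `A` (stated pointwise). -/
theorem stmt_1 {A : Type*} [CommRing A] (δ : Derivation ℤ A A) (Q₀ B : A)
    (hQ₀ : δ Q₀ = B * Q₀) (hB : δ B = 0) :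
    ∀ m : ℕ, 1 ≤ m → ∀ f : A,
      (fun g => Q₀ * δ g)^[m] f = Q₀ ^ m * factorComp (fun g => δ g) B m f := by
  intro m hm f
  clear hm
  induction m with
  | zero => simp [factorComp]
  | succ k ih =>
    simp only [Function.iterate_succ_apply', ih, factorComp, Function.comp_apply,
      Derivation.leibniz, δ.apply_pow_of_apply_eq_mul hQ₀, smul_eq_mul, nsmul_eq_mul]
    ring
end

section
/- Let A be a commutative ring, δ : A → A a derivation, and Q₀, Qs, As, B ∈ A elements satisfying δ(Q₀) = B·Q₀, δ(Qs) = As + B·Qs, δ(As) = 0 and δ(B) = 0. Then for every integer m ≥ 1, the element T^m(Qs), where T : A → A is the map T(f) = Q₀·δ(f), belongs to the principal ideal of A generated by Q₀^m. -/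
/-- If `q ∣ δ q`, the derivation `δ` preserves divisibility by powers of `q`. -/
theorem Derivation.pow_dvd_apply_of_dvd_apply {R A : Type*} [CommSemiring R] [CommSemiring A]
    [Algebra R A] (δ : Derivation R A A) {q f : A} (hq : q ∣ δ q) {n : ℕ} (hf : q ^ n ∣ f) :
    q ^ n ∣ δ f := by
  have hpow : q ^ n ∣ δ (q ^ n) := by
    clear hf
    induction n with
    | zero => simp
    | succ k ih =>
      rw [pow_succ, δ.leibniz, smul_eq_mul, smul_eq_mul, mul_comm q]
      exact dvd_add (mul_dvd_mul_left _ hq) (mul_dvd_mul_right ih q)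
  obtain ⟨c, rfl⟩ := hf
  rw [δ.leibniz, smul_eq_mul, smul_eq_mul]
  exact dvd_add (dvd_mul_right _ _) (hpow.mul_left c)

/-- If `q ∣ δ q`, the `m`-th iterate of `f ↦ q * δ f` has values divisible by `q ^ m`. -/
theorem Derivation.pow_dvd_iterate_mul_apply {R A : Type*} [CommSemiring R] [CommSemiring A]
    [Algebra R A] (δ : Derivation R A A) {q : A} (hq : q ∣ δ q) (f : A) (m : ℕ) :
    q ^ m ∣ (fun f => q * δ f)^[m] f := by
  induction m with
  | zero => simp
  | succ k ih =>
    rw [Function.iterate_succ_apply', pow_succ']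
    exact mul_dvd_mul_left q (δ.pow_dvd_apply_of_dvd_apply hq ih)

/-- Iterates of `T : f ↦ Q₀·δ(f)` applied to `Qs` land in the principal ideal
generated by `Q₀^m`. -/
theorem stmt_4 {A : Type*} [CommRing A] (δ : Derivation ℤ A A) (Q₀ Qs As B : A)
    (hQ₀ : δ Q₀ = B * Q₀) (hQs : δ Qs = As + B * Qs) (hAs : δ As = 0) (hB : δ B = 0) :
    ∀ m : ℕ, 1 ≤ m →
      (fun f => Q₀ * δ f)^[m] Qs ∈ Ideal.span ({Q₀ ^ m} : Set A) := by
  intro m _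
  rw [Ideal.mem_span_singleton]
  exact δ.pow_dvd_iterate_mul_apply (hQ₀ ▸ dvd_mul_left Q₀ B) Qs m
end

section
/- Let p be a prime, A a commutative ring of characteristic p (CharP A p), δ : A → A a derivation, and Q₀, Qs, As, B ∈ A elements satisfying δ(Q₀) = B·Q₀, δ(Qs) = As + B·Qs, δ(As) = 0 and δ(B) = 0. Then for every integer m ≥ p, the m-th iterate of the map T : A → A, T(f) = Q₀·δ(f), satisfies T^m(Qs) = 0. -/
/-- Closed form for the positive iterates of `f ↦ Q₀ * δ f` on `Qs`. -/
theorem Derivation.iterate_mul_apply_succ {R A : Type*} [CommRing R] [CommRing A] [Algebra R A]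
    (δ : Derivation R A A) {Q₀ Qs As B : A}
    (hQ₀ : δ Q₀ = B * Q₀) (hQs : δ Qs = As + B * Qs) (hAs : δ As = 0) (hB : δ B = 0) (n : ℕ) :
    (fun f => Q₀ * δ f)^[n + 1] Qs =
      ((n + 1).factorial : A) * (Q₀ ^ (n + 1) * (B ^ (n + 1) * Qs + B ^ n * As)) := by
  induction n with
  | zero => simp [hQs, add_comm]
  | succ n ih =>
    have hBpow (k : ℕ) : δ (B ^ k) = 0 := by simp [Derivation.leibniz_pow, hB]
    rw [Function.iterate_succ_apply', ih, Nat.factorial_succ (n + 1)]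
    simp only [Derivation.leibniz, Derivation.leibniz_pow, Derivation.map_natCast, map_add, hBpow,
      hQ₀, hQs, hAs, smul_eq_mul, nsmul_eq_mul, Nat.add_sub_cancel]
    push_cast
    ring


/-- Vanishing criterion in characteristic `p`: all iterates of order `≥ p` of
`T : f ↦ Q₀·δ(f)` vanish on `Qs`. -/
theorem stmt_5 {p : ℕ} (hp : p.Prime) {A : Type*} [CommRing A] [CharP A p]
    (δ : Derivation ℤ A A) (Q₀ Qs As B : A)
    (hQ₀ : δ Q₀ = B * Q₀) (hQs : δ Qs = As + B * Qs) (hAs : δ As = 0) (hB : δ B = 0) :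
    ∀ m : ℕ, p ≤ m → (fun f => Q₀ * δ f)^[m] Qs = 0 := by
  intro m hm
  obtain ⟨n, rfl⟩ := Nat.exists_eq_succ_of_ne_zero (hp.pos.trans_le hm).ne'
  rw [Nat.succ_eq_add_one, δ.iterate_mul_apply_succ hQ₀ hQs hAs hB,
    (CharP.cast_eq_zero_iff A p _).2 (hp.dvd_factorial.2 hm), zero_mul]
end

section
/- Let p be a prime, A a commutative ring of characteristic p (CharP A p), δ : A → A a derivation, and Q₀, Qs, P, R ∈ A elements satisfying δ(Q₀) = R^p·Q₀ and δ(Qs) = P^p + R^p·Qs. Then for every F ∈ A one has Q₀·δ(Q₀^{p−1}·F^p·Qs) = (Q₀·F·P)^p, and moreover δ((Q₀·F·P)^p) = 0, so the element Q₀^{p−1}·F^p·Qs is mapped by T : f ↦ Q₀·δ(f) into the kernel of T. -/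
/-- In characteristic `p`, a derivation kills `p`-th powers. -/
theorem Derivation.apply_pow_char {p : ℕ} {A : Type*} [CommRing A] [CharP A p]
    (δ : Derivation ℤ A A) (a : A) : δ (a ^ p) = 0 := by
  rw [Derivation.leibniz_pow, nsmul_eq_mul, CharP.cast_eq_zero, zero_mul]

/-- Kernel family: in characteristic `p`, with `δ Q₀ = R^p·Q₀` and
`δ Qs = P^p + R^p·Qs`, one has `Q₀·δ(Q₀^{p−1}·F^p·Qs) = (Q₀·F·P)^p`, and
`δ((Q₀·F·P)^p) = 0`; hence `T : f ↦ Q₀·δ(f)` maps `Q₀^{p−1}·F^p·Qs` into the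
kernel of `T`. -/
theorem stmt_6 {p : ℕ} (hp : p.Prime) {A : Type*} [CommRing A] [CharP A p]
    (δ : Derivation ℤ A A) (Q₀ Qs P R : A)
    (hQ₀ : δ Q₀ = R ^ p * Q₀) (hQs : δ Qs = P ^ p + R ^ p * Qs) :
    ∀ F : A,
      Q₀ * δ (Q₀ ^ (p - 1) * F ^ p * Qs) = (Q₀ * F * P) ^ p ∧
      δ ((Q₀ * F * P) ^ p) = 0 ∧
      Q₀ * δ (Q₀ * δ (Q₀ ^ (p - 1) * F ^ p * Qs)) = 0 := by
  intro F
  have key : Q₀ * δ (Q₀ ^ (p - 1) * F ^ p * Qs) = (Q₀ * F * P) ^ p := by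
    have hF : δ (F ^ p) = 0 := δ.apply_pow_char F
    have hp₀ : (p : A) = 0 := CharP.cast_eq_zero A p
    obtain ⟨m, rfl⟩ := Nat.exists_eq_add_of_le' hp.two_le
    rw [show m + 2 - 1 = m + 1 from rfl]
    simp only [Derivation.leibniz, hF, Derivation.leibniz_pow δ Q₀, hQ₀, hQs, smul_eq_mul,
      nsmul_eq_mul, Nat.add_sub_cancel]
    push_cast at hp₀ ⊢
    linear_combination (Q₀ ^ (m + 2) * F ^ (m + 2) * R ^ (m + 2) * Qs) * hp₀
  have hker : δ ((Q₀ * F * P) ^ p) = 0 := δ.apply_pow_char _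
  exact ⟨key, hker, by rw [key, hker, mul_zero]⟩
end

section
/- Let k be a commutative ring, A a commutative k-algebra, δ : A → A a k-linear derivation, n a natural number, Q₀ a unit of A, and Q : Fin n → A, As : Fin n → A families with B ∈ A such that δ(Q₀) = B·Q₀ and δ(Q s) = As s + B·(Q s) for every s. Define the normalized ratios R : Fin n → A by R s := (Q s)·Q₀⁻¹. Then for every multivariate polynomial Φ ∈ MvPolynomial (Fin n) k, one has Q₀ · δ(aeval R Φ) = Σ_{s ∈ Fin n} (aeval R (pderiv s Φ)) · (As s). -/
open MvPolynomial

/-- The chain rule for a derivation applied to a polynomial expression. -/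
theorem Derivation.map_mvPolynomial_aeval {k A σ : Type*} [CommRing k] [CommRing A] [Algebra k A]
    [Fintype σ] (δ : Derivation k A A) (x : σ → A) (Φ : MvPolynomial σ k) :
    δ (aeval x Φ) = ∑ s, aeval x (pderiv s Φ) * δ (x s) := by
  classical
  induction Φ using MvPolynomial.induction_on with
  | C a => simp
  | add p q hp hq => simp [hp, hq, add_mul, Finset.sum_add_distrib]
  | mul_X p i hp =>
    simp only [map_mul, aeval_X, Derivation.leibniz, hp, smul_eq_mul, map_add, pderiv_X, add_mul,
      Finset.sum_add_distrib, Finset.mul_sum, mul_assoc]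
    congr 1
    simp [Pi.single_apply, apply_ite (aeval x)]

/-- If `δ a = b * a` for a unit `a`, then `a * δ (q * a⁻¹) = δ q - b * q`. -/
theorem Derivation.unit_mul_map_mul_inv {k A : Type*} [CommRing k] [CommRing A] [Algebra k A]
    (δ : Derivation k A A) (a : Aˣ) {b : A} (ha : δ (a : A) = b * a) (q : A) :
    (a : A) * δ (q * (↑a⁻¹ : A)) = δ q - b * q := by
  have h : (a : A) * (↑a⁻¹ : A) = 1 := a.mul_inv
  have hq := δ.leibniz (q * (↑a⁻¹ : A)) (a : A)
  rw [Units.inv_mul_cancel_right, ha, smul_eq_mul, smul_eq_mul] at hq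
  linear_combination (-b * q) * h - hq

/-- Formula (B.2): in the normalized coordinates `R s = (Q s)·Q₀⁻¹`, the operator
`f ↦ Q₀·δ(f)` acts on polynomials in the `R s` as a first-order differential
operator with constant coefficients `As s`. -/
theorem stmt_13 {k : Type*} [CommRing k] {A : Type*} [CommRing A] [Algebra k A]
    (δ : Derivation k A A) (n : ℕ) (Q₀ : Aˣ) (Q As : Fin n → A) (B : A)
    (hQ₀ : δ (Q₀ : A) = B * (Q₀ : A))
    (hQ : ∀ s, δ (Q s) = As s + B * Q s) :
    ∀ Φ : MvPolynomial (Fin n) k,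
      (Q₀ : A) * δ (aeval (fun s => Q s * (↑Q₀⁻¹ : A)) Φ)
        = ∑ s : Fin n, aeval (fun s => Q s * (↑Q₀⁻¹ : A)) (pderiv s Φ) * As s := by
  intro Φ
  rw [δ.map_mvPolynomial_aeval, Finset.mul_sum]
  refine Finset.sum_congr rfl fun s _ => ?_
  rw [mul_left_comm, δ.unit_mul_map_mul_inv Q₀ hQ₀, hQ, add_sub_cancel_right]
end

section
/- Let k be a commutative ring, A a commutative k-algebra, δ : A → A a k-linear derivation, n a natural number, Q₀ and B units of A, and Q : Fin n → A, As : Fin n → A families such that δ(Q₀) = B·Q₀, δ(Q s) = As s + B·(Q s), δ(As s) = 0 for every s, and δ(B) = 0. Define I : Fin n → A by I s := ((Q s) + B⁻¹·(As s))·Q₀⁻¹. Then for every multivariate polynomial Φ ∈ MvPolynomial (Fin n) k, one has δ(aeval I Φ) = 0. -/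
open MvPolynomial

/-- A derivation that kills every value of a family kills every polynomial in that family. -/
theorem Derivation.map_mvPolynomial_aeval_eq_zero {k A σ : Type*} [CommRing k] [CommRing A]
    [Algebra k A] (δ : Derivation k A A) {f : σ → A} (hf : ∀ s, δ (f s) = 0)
    (Φ : MvPolynomial σ k) : δ (aeval f Φ) = 0 := by
  induction Φ using MvPolynomial.induction_on with
  | C a => simp
  | add p q hp hq => simp [hp, hq]
  | mul_X p s hp => simp [hp, hf]

/-- Every polynomial in the invariant ratios `I s = (Q s + B⁻¹·As s)·Q₀⁻¹`
lies in the kernel of the normalized derivation `δ`. -/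
theorem stmt_14 {k : Type*} [CommRing k] {A : Type*} [CommRing A] [Algebra k A]
    (δ : Derivation k A A) (n : ℕ) (Q₀ B : Aˣ) (Q As : Fin n → A)
    (hQ₀ : δ (Q₀ : A) = (B : A) * (Q₀ : A))
    (hQ : ∀ s, δ (Q s) = As s + (B : A) * Q s)
    (hAs : ∀ s, δ (As s) = 0) (hB : δ (B : A) = 0) :
    ∀ Φ : MvPolynomial (Fin n) k,
      δ (aeval (fun s => (Q s + (↑B⁻¹ : A) * As s) * (↑Q₀⁻¹ : A)) Φ) = 0 := by
  refine δ.map_mvPolynomial_aeval_eq_zero fun s => ?_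
  have hBinv : δ (↑B⁻¹ : A) = 0 := by
    rw [δ.leibniz_of_mul_eq_one B.inv_mul, hB, smul_zero]
  have hQ₀inv : δ (↑Q₀⁻¹ : A) = -((B : A) * ↑Q₀⁻¹) := by
    rw [δ.leibniz_of_mul_eq_one Q₀.inv_mul, hQ₀, smul_eq_mul]
    linear_combination (-(B : A) * ↑Q₀⁻¹) * Q₀.inv_mul
  simp only [Derivation.leibniz, map_add, hQ, hAs, hBinv, hQ₀inv, smul_eq_mul]
  linear_combination (-(As s) * ↑Q₀⁻¹) * B.inv_mul
end
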